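/- Let p̂ = (1/n)Σ_{i=1}^n δ_{x_i} and q̂ = (1/m)Σ_{j=1}^m δ_{y_j} be discrete probability measures on ℝ^d, and define the Gram matrices K_{p̂} = (k(x_i,x_j))_{i,j} ∈ ℝ^{n×n}, K_{q̂} = (k(y_i,y_j))_{i,j} ∈ ℝ^{m×m}, K_{p̂,q̂} = (k(x_i,y_j))_{i,j} ∈ ℝ^{n×m}. Then for any α ∈ (0,1), KKL_α(p̂||q̂) = Tr( (1/n) K_{p̂} log((1/n) K_{p̂}) ) − Tr( I_α K log K ), where I_α ∈ ℝ^{(n+m)×(n+m)} is the block matrix with (1/α)·Id_n in the top-left block and zeros elsewhere, and K ∈ ℝ^{(n+m)×(n+m)} is the block matrix with blocks (α/n) K_{p̂}, √(α(1−α)/(nm)) K_{p̂,q̂}, √(α(1−α)/(nm)) K_{q̂,p̂}, and ((1−α)/m) K_{q̂}. -/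

import Mathlib

open MeasureTheory RealInnerProductSpace Matrix
open scoped ENNReal

noncomputable section

universe u

/-- Rank-one operator `u v^*` : `f ↦ ⟪v, f⟫ • u`. -/
def rankOne {H : Type u} [NormedAddCommGroup H] [InnerProductSpace ℝ H] (u v : H) :
    H →L[ℝ] H := (innerSL ℝ v).smulRight u

/-- Covariance operator `Σ_p = ∫ φ(x) ⊗ φ(x) dp(x)`. -/
def covOp {d : ℕ} {H : Type u} [NormedAddCommGroup H] [InnerProductSpace ℝ H]
    [CompleteSpace H] (φ : EuclideanSpace ℝ (Fin d) → H)
    (p : Measure (EuclideanSpace ℝ (Fin d))) : H →L[ℝ] H :=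
  ∫ x, rankOne (φ x) (φ x) ∂p

/-- The empirical measure `(1/n) ∑ᵢ δ_{x_i}`. -/
def empMeas {d n : ℕ} (xs : Fin n → EuclideanSpace ℝ (Fin d)) :
    Measure (EuclideanSpace ℝ (Fin d)) :=
  (n : ℝ≥0∞)⁻¹ • ∑ i, Measure.dirac (xs i)

/-- `v` is the value of the regularized divergence
`KKL_α(p‖q) = Tr(Σ_p log Σ_p) - Tr(Σ_p log(αΣ_p + (1-α)Σ_q))`, expressed through
spectral decompositions of `Σ_p` and `αΣ_p + (1-α)Σ_q`. -/
def IsKKLa {d : ℕ} {H : Type u} [NormedAddCommGroup H] [InnerProductSpace ℝ H]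
    [CompleteSpace H] (φ : EuclideanSpace ℝ (Fin d) → H) (α : ℝ)
    (p q : Measure (EuclideanSpace ℝ (Fin d))) (v : ℝ) : Prop :=
  ∃ (ι : Type u) (f : HilbertBasis ι ℝ H) (lam : ι → ℝ)
    (g : HilbertBasis ι ℝ H) (gam : ι → ℝ),
    (∀ i, covOp φ p (f i) = lam i • f i) ∧ (∀ i, 0 ≤ lam i) ∧
    (∀ j, (α • covOp φ p + (1 - α) • covOp φ q) (g j) = gam j • g j) ∧ (∀ j, 0 ≤ gam j) ∧
    Summable (fun ij : ι × ι =>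
      lam ij.1 * Real.log (lam ij.1 / gam ij.2) * ⟪(f ij.1 : H), (g ij.2 : H)⟫ ^ 2) ∧
    v = ∑' ij : ι × ι,
      lam ij.1 * Real.log (lam ij.1 / gam ij.2) * ⟪(f ij.1 : H), (g ij.2 : H)⟫ ^ 2

/-- Spectral functional calculus for real symmetric matrices: `matFun g M` applies `g`
to the eigenvalues of `M` (and returns `0` if `M` is not symmetric). -/
def matFun {N : Type*} [Fintype N] [DecidableEq N] (g : ℝ → ℝ) (M : Matrix N N ℝ) :
    Matrix N N ℝ :=
  if h : M.IsHermitian then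
    (h.eigenvectorUnitary : Matrix N N ℝ) * Matrix.diagonal (g ∘ h.eigenvalues) *
      star (h.eigenvectorUnitary : Matrix N N ℝ)
  else 0

theorem hasSum_congr_real {ι : Type*} {F G : ι → ℝ} {a : ℝ} (h : ∀ j, F j = G j) :
    HasSum F a ↔ HasSum G a := by
  rw [funext h]

/-- Key lemma: matrix entries of the functional calculus of a Gram matrix. -/
theorem gram_matFun {H : Type u} [NormedAddCommGroup H] [InnerProductSpace ℝ H] [CompleteSpace H]
    {N : Type} [Fintype N] [DecidableEq N] (ψ : N → H) (K : Matrix N N ℝ)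
    (hK : ∀ a b, K a b = ⟪ψ a, ψ b⟫) {ι : Type u} (g : HilbertBasis ι ℝ H) (gam : ι → ℝ)
    (hg : ∀ j, ∑ a, ⟪ψ a, (g j : H)⟫ • ψ a = gam j • (g j : H)) (l : ℝ → ℝ) (b c : N) :
    HasSum (fun j => l (gam j) * (⟪ψ b, (g j : H)⟫ * ⟪(g j : H), ψ c⟫))
      (matFun (fun t => t * l t) K b c) := by
  have hH : K.IsHermitian := by
    ext a b
    simp [hK, real_inner_comm]
  set U : Matrix N N ℝ := (hH.eigenvectorUnitary : Matrix N N ℝ) with hU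
  set μ := hH.eigenvalues with hμ
  have hUU : U * star U = 1 := Unitary.coe_mul_star_self _
  have hUU' : star U * U = 1 := Unitary.coe_star_mul_self _
  have hspec : K = U * diagonal μ * star U := by
    have := hH.spectral_theorem
    simpa [Unitary.conjStarAlgAut_apply] using this
  have hKU : K * U = U * diagonal μ := by
    rw [hspec, Matrix.mul_assoc, hUU', Matrix.mul_one]
  have hKU' : ∀ e a, ∑ d, K e d * U d a = U e a * μ a := by
    intro e a
    have := congrFun (congrFun hKU e) a
    rw [Matrix.mul_diagonal, Matrix.mul_apply] at this
    exact this
  -- images of eigenvectors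
  let w : N → H := fun a => ∑ d, U d a • ψ d
  have hψw : ∀ e a, ⟪ψ e, w a⟫ = U e a * μ a := by
    intro e a
    rw [← hKU' e a]
    simp only [w, inner_sum, inner_smul_right, hK]
    exact Finset.sum_congr rfl fun d _ => mul_comm _ _
  have hww : ∀ a a', ⟪w a, w a'⟫ = if a = a' then μ a else 0 := by
    intro a a'
    have h1 : ⟪w a, w a'⟫ = (∑ d, U d a * U d a') * μ a' := by
      conv_lhs => simp only [w, sum_inner, inner_smul_left]
      rw [Finset.sum_mul]
      refine Finset.sum_congr rfl fun d _ => ?_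
      have := hψw d a'
      simp only [w] at this
      rw [this]
      simp [mul_assoc]
    have h2 := congrFun (congrFun hUU' a) a'
    rw [Matrix.mul_apply] at h2
    simp only [Matrix.star_apply, star_trivial, Matrix.one_apply] at h2
    rw [h1, h2]
    split_ifs with h <;> simp [h]
  have hψ : ∀ b, ψ b = ∑ a, U b a • w a := by
    intro b
    simp only [w, Finset.smul_sum, smul_smul]
    rw [Finset.sum_comm]
    have h2 : ∀ d, ∑ a, U b a * U d a = if b = d then 1 else 0 := by
      intro d
      have h2 := congrFun (congrFun hUU b) d
      rw [Matrix.mul_apply] at h2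
      simpa only [Matrix.star_apply, star_trivial, Matrix.one_apply] using h2
    simp only [← Finset.sum_smul, h2]
    simp
  have hC : ∀ j a, gam j * ⟪(g j : H), w a⟫ = μ a * ⟪(g j : H), w a⟫ := by
    intro j a
    have h1 : gam j * ⟪(g j : H), w a⟫ = ∑ e, ⟪ψ e, (g j : H)⟫ * (U e a * μ a) := by
      rw [← real_inner_smul_left, ← hg, sum_inner]
      simp only [real_inner_smul_left, hψw]
    rw [h1]
    simp only [w, inner_sum, real_inner_smul_right, Finset.mul_sum]
    refine Finset.sum_congr rfl fun e _ => ?_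
    rw [real_inner_comm]; ring
  have hl : ∀ j a, l (gam j) * ⟪(g j : H), w a⟫ = l (μ a) * ⟪(g j : H), w a⟫ := by
    intro j a
    by_cases h : ⟪(g j : H), w a⟫ = 0
    · simp [h]
    · rw [mul_right_cancel₀ h (hC j a)]
  have hval : matFun (fun t => t * l t) K b c
      = ∑ a, ∑ a', (l (μ a) * U b a * U c a') * ⟪w a, w a'⟫ := by
    unfold matFun
    rw [dif_pos hH, Matrix.mul_apply]
    refine Finset.sum_congr rfl fun a _ => ?_
    simp only [hww]
    rw [Matrix.mul_diagonal]
    simp only [Function.comp, mul_ite, mul_zero, Finset.sum_ite_eq, Finset.mem_univ, if_true,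
      Matrix.star_apply, star_trivial]
    ring
  rw [hval]
  have hfun : (fun j => l (gam j) * (⟪ψ b, (g j : H)⟫ * ⟪(g j : H), ψ c⟫))
      = fun j => ∑ a, ∑ a', (l (μ a) * U b a * U c a') * (⟪w a, (g j : H)⟫ * ⟪(g j : H), w a'⟫) := by
    funext j
    rw [hψ b, hψ c]
    simp only [sum_inner, inner_sum, real_inner_smul_left, real_inner_smul_right]
    rw [Finset.sum_mul_sum, Finset.mul_sum]
    refine Finset.sum_congr rfl fun a _ => ?_
    rw [Finset.mul_sum]
    refine Finset.sum_congr rfl fun a' _ => ?_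
    have := hl j a
    rw [real_inner_comm] at this
    linear_combination (U b a * U c a' * ⟪(g j : H), w a'⟫) * this
  rw [hfun]
  exact hasSum_sum fun a _ => hasSum_sum fun a' _ => (g.hasSum_inner_mul_inner _ _).mul_left _

theorem covOp_emp {d n : ℕ} {H : Type u} [NormedAddCommGroup H] [InnerProductSpace ℝ H]
    [CompleteSpace H] (φ : EuclideanSpace ℝ (Fin d) → H)
    (x : Fin n → EuclideanSpace ℝ (Fin d)) (h : H) :
    covOp φ (empMeas x) h = (n : ℝ)⁻¹ • ∑ i, ⟪φ (x i), h⟫ • φ (x i) := by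
  unfold covOp empMeas
  rw [integral_smul_measure, integral_finsetSum_measure]
  · simp [integral_dirac, rankOne]
  · intro i _
    exact integrable_dirac (by simp)

/-- **Closed form of the regularized kernel KL divergence for discrete measures.**
For `p̂ = (1/n)∑δ_{x_i}`, `q̂ = (1/m)∑δ_{y_j}` and Gram matrices `Kp, Kq, Kpq, Kqp`,
`KKL_α(p̂‖q̂) = Tr((1/n)Kp log((1/n)Kp)) - Tr(I_α K log K)` where `I_α` and `K` are
the indicated block matrices. -/
theorem kkl_alpha_discrete_closed_form {d n m : ℕ} (hn : 0 < n) (hm : 0 < m)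
    {H : Type u} [NormedAddCommGroup H] [InnerProductSpace ℝ H] [CompleteSpace H]
    (k : EuclideanSpace ℝ (Fin d) → EuclideanSpace ℝ (Fin d) → ℝ)
    (φ : EuclideanSpace ℝ (Fin d) → H) (hφc : Continuous φ)
    (hk : ∀ x y, k x y = ⟪φ x, φ y⟫) (hk1 : ∀ x, k x x = 1)
    (x : Fin n → EuclideanSpace ℝ (Fin d)) (y : Fin m → EuclideanSpace ℝ (Fin d))
    (α : ℝ) (hα : α ∈ Set.Ioo (0 : ℝ) 1)
    (Kp : Matrix (Fin n) (Fin n) ℝ) (hKp : ∀ i j, Kp i j = k (x i) (x j))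
    (Kq : Matrix (Fin m) (Fin m) ℝ) (hKq : ∀ i j, Kq i j = k (y i) (y j))
    (Kpq : Matrix (Fin n) (Fin m) ℝ) (hKpq : ∀ i j, Kpq i j = k (x i) (y j))
    (Kqp : Matrix (Fin m) (Fin n) ℝ) (hKqp : ∀ i j, Kqp i j = k (y i) (x j))
    (v : ℝ) (hv : IsKKLa φ α (empMeas x) (empMeas y) v) :
    v = (matFun (fun t => t * Real.log t) ((n : ℝ)⁻¹ • Kp)).trace
        - (Matrix.fromBlocks (α⁻¹ • (1 : Matrix (Fin n) (Fin n) ℝ)) 0 0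
              (0 : Matrix (Fin m) (Fin m) ℝ)
            * matFun (fun t => t * Real.log t)
              (Matrix.fromBlocks ((α / n) • Kp)
                (Real.sqrt (α * (1 - α) / (n * m)) • Kpq)
                (Real.sqrt (α * (1 - α) / (n * m)) • Kqp)
                (((1 - α) / m) • Kq))).trace := by
  obtain ⟨ι, f, lam, g, gam, hf, hlam, hg, hgam, hsum, rfl⟩ := hv
  obtain ⟨hα0, hα1⟩ := hα
  have hn' : (0:ℝ) < n := by exact_mod_cast hn
  have hm' : (0:ℝ) < m := by exact_mod_cast hm
  have h1α : 0 < 1 - α := by linarith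
  simp only [_root_.add_apply, _root_.smul_apply] at hg
  set T := covOp φ (empMeas x) with hT
  -- quadratic forms
  have hTq : ∀ h h' : H, ⟪h, T h'⟫ = (n : ℝ)⁻¹ * ∑ i, ⟪φ (x i), h⟫ * ⟪φ (x i), h'⟫ := by
    intro h h'
    rw [hT, covOp_emp, real_inner_smul_right, inner_sum]
    congr 1
    refine Finset.sum_congr rfl fun i _ => ?_
    rw [real_inner_smul_right, real_inner_comm h]; ring
  have hSq : ∀ h h' : H, ⟪h, covOp φ (empMeas y) h'⟫
      = (m : ℝ)⁻¹ * ∑ i, ⟪φ (y i), h⟫ * ⟪φ (y i), h'⟫ := by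
    intro h h'
    rw [covOp_emp, real_inner_smul_right, inner_sum]
    congr 1
    refine Finset.sum_congr rfl fun i _ => ?_
    rw [real_inner_smul_right, real_inner_comm h]; ring
  have hTsym : ∀ h h' : H, ⟪T h, h'⟫ = ⟪h, T h'⟫ := by
    intro h h'
    rw [real_inner_comm, hTq, hTq]
    simp only [mul_comm]
  have hff : ∀ i, ⟪(f i : H), (f i : H)⟫ = 1 := by
    intro i
    rw [real_inner_self_eq_norm_sq, f.orthonormal.1 i]; norm_num
  -- first trace
  have hA : HasSum (fun i => lam i * Real.log (lam i))
      (matFun (fun t => t * Real.log t) ((n : ℝ)⁻¹ • Kp)).trace := by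
    have key := gram_matFun (fun i => Real.sqrt (n : ℝ)⁻¹ • φ (x i)) ((n : ℝ)⁻¹ • Kp)
      (by
        intro a b
        rw [Matrix.smul_apply, hKp, hk, real_inner_smul_left, real_inner_smul_right, ← mul_assoc,
          Real.mul_self_sqrt (by positivity), smul_eq_mul]) f lam
      (by
        intro j
        rw [← hf j, hT, covOp_emp, Finset.smul_sum]
        refine Finset.sum_congr rfl fun i _ => ?_
        rw [real_inner_smul_left, smul_smul, smul_smul]
        congr 1
        have := Real.mul_self_sqrt (show (0:ℝ) ≤ (n:ℝ)⁻¹ by positivity)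
        linear_combination ⟪φ (x i), (f j : H)⟫ * this) Real.log
    have := hasSum_sum (s := Finset.univ) fun b _ => key b b
    unfold Matrix.trace
    simp only [Matrix.diag_apply]
    refine (hasSum_congr_real fun j => ?_).mpr this
    rw [← Finset.mul_sum, mul_comm]
    congr 1
    have h1 : lam j = ⟪(f j : H), T (f j)⟫ := by
      rw [hf, real_inner_smul_right, hff, mul_one]
    rw [h1, hTq, Finset.mul_sum]
    refine Finset.sum_congr rfl fun i _ => ?_
    rw [real_inner_smul_left, real_inner_smul_right, real_inner_comm (φ (x i))]
    have := Real.mul_self_sqrt (show (0:ℝ) ≤ (n:ℝ)⁻¹ by positivity)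
    linear_combination (-⟪φ (x i), (f j : H)⟫ * ⟪φ (x i), (f j : H)⟫) * this
  -- second trace
  set K := Matrix.fromBlocks ((α / n) • Kp)
                (Real.sqrt (α * (1 - α) / (n * m)) • Kpq)
                (Real.sqrt (α * (1 - α) / (n * m)) • Kqp)
                (((1 - α) / m) • Kq) with hKdef
  have hs1 := Real.mul_self_sqrt (show (0:ℝ) ≤ α / n by positivity)
  have hs2 := Real.mul_self_sqrt (show (0:ℝ) ≤ (1 - α) / m by positivity)
  have hs3 : Real.sqrt (α * (1 - α) / (n * m)) = Real.sqrt (α / n) * Real.sqrt ((1 - α) / m) := by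
    rw [← Real.sqrt_mul (by positivity)]
    congr 1
    field_simp
  have hB : HasSum (fun j => Real.log (gam j) * ⟪(g j : H), T (g j)⟫)
      (Matrix.fromBlocks (α⁻¹ • (1 : Matrix (Fin n) (Fin n) ℝ)) 0 0
              (0 : Matrix (Fin m) (Fin m) ℝ)
            * matFun (fun t => t * Real.log t) K).trace := by
    have key := gram_matFun (Sum.elim (fun i => Real.sqrt (α / n) • φ (x i))
        (fun i => Real.sqrt ((1 - α) / m) • φ (y i))) K
      (by
        rintro (a | a) (b | b) <;>
        simp only [hKdef, Matrix.fromBlocks_apply₁₁, Matrix.fromBlocks_apply₁₂,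
          Matrix.fromBlocks_apply₂₁, Matrix.fromBlocks_apply₂₂, Matrix.smul_apply, hKp, hKq, hKpq,
          hKqp, hk, Sum.elim_inl, Sum.elim_inr, real_inner_smul_left, real_inner_smul_right,
          smul_eq_mul, hs3, ← mul_assoc, hs1, hs2]
        ring) g gam
      (by
        intro j
        rw [← hg j, hT, covOp_emp, covOp_emp, Fintype.sum_sum_type]
        simp only [Sum.elim_inl, Sum.elim_inr, Finset.smul_sum]
        congr 1
        · refine Finset.sum_congr rfl fun i _ => ?_
          rw [real_inner_smul_left, smul_smul, smul_smul, smul_smul]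
          congr 1
          linear_combination ⟪φ (x i), (g j : H)⟫ * hs1
        · refine Finset.sum_congr rfl fun i _ => ?_
          rw [real_inner_smul_left, smul_smul, smul_smul, smul_smul]
          congr 1
          linear_combination ⟪φ (y i), (g j : H)⟫ * hs2) Real.log
    have hs := (hasSum_sum (s := Finset.univ) fun (b : Fin n) _ =>
      key (Sum.inl b) (Sum.inl b)).mul_left α⁻¹
    have htr : (Matrix.fromBlocks (α⁻¹ • (1 : Matrix (Fin n) (Fin n) ℝ)) 0 0
              (0 : Matrix (Fin m) (Fin m) ℝ)
            * matFun (fun t => t * Real.log t) K).trace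
        = α⁻¹ * ∑ b : Fin n, matFun (fun t => t * Real.log t) K (Sum.inl b) (Sum.inl b) := by
      generalize matFun (fun t => t * Real.log t) K = M
      rw [← Matrix.fromBlocks_toBlocks M, Matrix.fromBlocks_multiply]
      simp [Fintype.sum_sum_type, Finset.mul_sum, Matrix.trace, Matrix.toBlocks₁₁]
    rw [htr]
    refine (hasSum_congr_real fun j => ?_).mpr hs
    simp only [hTq, Finset.mul_sum]
    refine Finset.sum_congr rfl fun i _ => ?_
    simp only [Sum.elim_inl]
    rw [real_inner_smul_left, real_inner_smul_right, real_inner_comm (φ (x i)) (g j : H)]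
    have h3 : α⁻¹ * (Real.sqrt (α / n) * Real.sqrt (α / n)) = (n:ℝ)⁻¹ := by
      rw [hs1]; field_simp
    linear_combination (-Real.log (gam j) * ⟪φ (x i), (g j : H)⟫ * ⟪φ (x i), (g j : H)⟫) * h3
  -- degenerate case
  have hker : ∀ i j, gam j = 0 → lam i * ⟪(f i : H), (g j : H)⟫ = 0 := by
    intro i j h0
    have h1 : α * ⟪(g j : H), T (g j)⟫ + (1 - α) * ⟪(g j : H), covOp φ (empMeas y) (g j)⟫ = 0 := by
      rw [← real_inner_smul_right, ← real_inner_smul_right, ← inner_add_right, hg j, h0]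
      simp
    have h2 : 0 ≤ ⟪(g j : H), covOp φ (empMeas y) (g j)⟫ := by
      rw [hSq]
      exact mul_nonneg (by positivity) (Finset.sum_nonneg fun i _ => mul_self_nonneg _)
    have h3 : 0 ≤ ∑ i, ⟪φ (x i), (g j : H)⟫ * ⟪φ (x i), (g j : H)⟫ :=
      Finset.sum_nonneg fun i _ => mul_self_nonneg _
    have h4 : ∑ i, ⟪φ (x i), (g j : H)⟫ * ⟪φ (x i), (g j : H)⟫ = 0 := by
      rw [hTq] at h1
      have h5 : 0 ≤ (1 - α) * ⟪(g j : H), covOp φ (empMeas y) (g j)⟫ := mul_nonneg h1α.le h2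
      by_contra hne
      have h6 : 0 < ∑ i, ⟪φ (x i), (g j : H)⟫ * ⟪φ (x i), (g j : H)⟫ :=
        lt_of_le_of_ne h3 (Ne.symm hne)
      have h7 : 0 < α * ((n:ℝ)⁻¹ * ∑ i, ⟪φ (x i), (g j : H)⟫ * ⟪φ (x i), (g j : H)⟫) := by
        positivity
      linarith
    rw [Finset.sum_eq_zero_iff_of_nonneg (fun i _ => mul_self_nonneg _)] at h4
    rw [← real_inner_smul_left, ← hf i, hTsym, hTq]
    rw [Finset.sum_eq_zero, mul_zero]
    intro i' hi'
    rw [mul_self_eq_zero.mp (h4 i' hi'), mul_zero]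
  have hsplit : ∀ ij : ι × ι,
      lam ij.1 * Real.log (lam ij.1 / gam ij.2) * ⟪(f ij.1 : H), (g ij.2 : H)⟫ ^ 2
      = lam ij.1 * Real.log (lam ij.1) * ⟪(f ij.1 : H), (g ij.2 : H)⟫ ^ 2
        - Real.log (gam ij.2) * (lam ij.1 * ⟪(f ij.1 : H), (g ij.2 : H)⟫ ^ 2) := by
    rintro ⟨i, j⟩
    dsimp only
    by_cases h1 : lam i = 0
    · simp [h1]
    by_cases h2 : gam j = 0
    · have := (mul_eq_zero.mp (hker i j h2)).resolve_left h1
      simp [this]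
    rw [Real.log_div h1 h2]; ring
  have hpars : ∀ i, HasSum (fun j => ⟪(f i : H), (g j : H)⟫ ^ 2) 1 := by
    intro i
    have := g.hasSum_inner_mul_inner (f i : H) (f i : H)
    rw [hff] at this
    refine (hasSum_congr_real fun j => ?_).mpr this
    rw [real_inner_comm (f i : H) (g j : H)]; ring
  have hP : Summable (fun ij : ι × ι =>
      lam ij.1 * Real.log (lam ij.1) * ⟪(f ij.1 : H), (g ij.2 : H)⟫ ^ 2) := by
    rw [← summable_abs_iff]
    rw [summable_prod_of_nonneg (fun _ => abs_nonneg _)]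
    have h1 : ∀ i, HasSum (fun j => |lam i * Real.log (lam i) * ⟪(f i : H), (g j : H)⟫ ^ 2|)
        |lam i * Real.log (lam i)| := by
      intro i
      have := (hpars i).mul_left |lam i * Real.log (lam i)|
      rw [mul_one] at this
      refine (hasSum_congr_real fun j => ?_).mpr this
      rw [abs_mul, abs_of_nonneg (sq_nonneg ⟪(f i : H), (g j : H)⟫)]
    refine ⟨fun i => (h1 i).summable, ?_⟩
    simp only [fun i => (h1 i).tsum_eq]
    exact hA.summable.abs
  have hQ : Summable (fun ij : ι × ι =>
      Real.log (gam ij.2) * (lam ij.1 * ⟪(f ij.1 : H), (g ij.2 : H)⟫ ^ 2)) := by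
    refine (hP.sub hsum).congr fun ij => ?_
    rw [hsplit]; ring
  have hPv := hP.hasSum.prod_fiberwise
    (fun i => (hpars i).mul_left (lam i * Real.log (lam i)))
  simp only [mul_one] at hPv
  have hQ' := (Equiv.prodComm ι ι).summable_iff.mpr hQ
  have hQv := ((Equiv.prodComm ι ι).hasSum_iff.mpr hQ.hasSum).prod_fiberwise
    (g := fun j => Real.log (gam j) * ⟪(g j : H), T (g j)⟫) (by
      intro j
      refine HasSum.mul_left _ ?_
      have := f.hasSum_inner_mul_inner (g j : H) (T (g j))
      refine (hasSum_congr_real fun i => ?_).mpr this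
      simp only [Equiv.prodComm_apply, Prod.swap]
      rw [← hTsym, hf, real_inner_smul_left, real_inner_comm (f i : H) (g j : H)]
      ring)
  simp only [hsplit]
  rw [hP.tsum_sub hQ, hPv.unique hA, hQv.unique hB]
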